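/- For each 1 ≤ i ≤ k and each integer m ≥ 1 let Λ^i_m be a nonempty finite subset of ℝ^p satisfying the superadditivity Λ^i_m + Λ^i_{m'} ⊆ Λ^i_{m+m'} (Minkowski sum), and suppose there is B > 0 with Λ^i_m contained in the closed ball of radius B·m around 0 for all i and m. Set P^i := closure of the convex hull of ∪_{m≥1} (1/m)·Λ^i_m. Define Λ_m := Λ^1_m + ⋯ + Λ^k_m (Minkowski sum) and P := closure of the convex hull of ∪_{m≥1} (1/m)·Λ_m. Then P = P^1 + ⋯ + P^k (Minkowski sum). (This is the abstract content of Lemma 3.1(1) of the paper: the moment polytope of L = L₁ + ⋯ + L_k is the Minkowski sum of the moment polytopes of the Lᵢ.) -/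

import Mathlib

open Pointwise

theorem nsmul_mem_of_superadditive {E : Type*} [AddCommMonoid E] (L : ℕ → Set E)
    (hadd : ∀ m m' : ℕ, 1 ≤ m → 1 ≤ m' → L m + L m' ⊆ L (m + m'))
    (m : ℕ) (hm : 1 ≤ m) (a : E) (ha : a ∈ L m) (n : ℕ) : (n + 1) • a ∈ L ((n + 1) * m) := by
  induction n with
  | zero => simpa using ha
  | succ n ih =>
    have h := hadd ((n + 1) * m) m (Nat.mul_pos (Nat.succ_pos n) hm) hm (Set.add_mem_add ih ha)
    rw [succ_nsmul, Nat.succ_mul (n + 1) m]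
    exact h

/-- For each `1 ≤ i ≤ k` and each integer `m ≥ 1` let `Λ^i_m` be a nonempty finite
subset of `ℝ^p` satisfying the superadditivity `Λ^i_m + Λ^i_{m'} ⊆ Λ^i_{m+m'}`
(Minkowski sum), and suppose there is `B > 0` with `Λ^i_m` contained in the closed ball
of radius `B·m` around `0` for all `i` and `m`.  Set `P^i` := closure of the convex hull
of `∪_{m≥1} (1/m)·Λ^i_m`.  Define `Λ_m := Λ^1_m + ⋯ + Λ^k_m` (Minkowski sum) and
`P` := closure of the convex hull of `∪_{m≥1} (1/m)·Λ_m`.  Then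
`P = P^1 + ⋯ + P^k` (Minkowski sum). -/
theorem moment_polytope_of_sum_eq_minkowski_sum
    {p k : ℕ} (Λ : Fin k → ℕ → Set (EuclideanSpace ℝ (Fin p))) (B : ℝ) (hB : 0 < B)
    (hne : ∀ (i : Fin k) (m : ℕ), 1 ≤ m → (Λ i m).Nonempty)
    (hfin : ∀ (i : Fin k) (m : ℕ), 1 ≤ m → (Λ i m).Finite)
    (hadd : ∀ (i : Fin k) (m m' : ℕ), 1 ≤ m → 1 ≤ m' → Λ i m + Λ i m' ⊆ Λ i (m + m'))
    (hbdd : ∀ (i : Fin k) (m : ℕ), 1 ≤ m → ∀ a ∈ Λ i m, ‖a‖ ≤ B * m) :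
    closure (convexHull ℝ (⋃ (m : ℕ) (_ : 1 ≤ m), ((m : ℝ)⁻¹ • (∑ i, Λ i m)))) =
      ∑ i, closure (convexHull ℝ (⋃ (m : ℕ) (_ : 1 ≤ m), ((m : ℝ)⁻¹ • Λ i m))) := by
  classical
  apply Set.Subset.antisymm
  · have hcompact : ∀ i, IsCompact
        (closure (convexHull ℝ (⋃ (m : ℕ) (_ : 1 ≤ m), ((m : ℝ)⁻¹ • Λ i m)))) := by
      intro i
      apply Bornology.IsBounded.isCompact_closure
      rw [isBounded_convexHull]
      refine (Metric.isBounded_closedBall (x := 0) (r := B)).subset ?_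
      intro x hx
      simp only [Set.mem_iUnion] at hx
      obtain ⟨m, hm, a, ha, rfl⟩ := hx
      have hm' : (0 : ℝ) < m := by exact_mod_cast hm
      simp only [mem_closedBall_zero_iff, norm_smul, norm_inv, Real.norm_natCast]
      rw [inv_mul_le_iff₀ hm', mul_comm]
      exact hbdd i m hm a ha
    have hcs : ∀ s : Finset (Fin k), IsCompact (∑ i ∈ s,
        closure (convexHull ℝ (⋃ (m : ℕ) (_ : 1 ≤ m), ((m : ℝ)⁻¹ • Λ i m)))) ∧ Convex ℝ (∑ i ∈ s,
        closure (convexHull ℝ (⋃ (m : ℕ) (_ : 1 ≤ m), ((m : ℝ)⁻¹ • Λ i m)))) := by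
      intro s
      induction s using Finset.induction_on with
      | empty => exact ⟨by simpa using isCompact_singleton, by simpa using convex_zero⟩
      | insert i s hi ih =>
        rw [Finset.sum_insert hi]
        exact ⟨(hcompact i).add ih.1, (convex_convexHull ℝ _).closure.add ih.2⟩
    refine closure_minimal (convexHull_min ?_ (hcs _).2) (hcs _).1.isClosed
    intro x hx
    simp only [Set.mem_iUnion] at hx
    obtain ⟨m, hm, a, ha, rfl⟩ := hx
    obtain ⟨g, hg, rfl⟩ := Set.mem_fintype_sum _ _ |>.1 ha
    refine (Set.mem_fintype_sum _ _).2 ⟨fun i => (m : ℝ)⁻¹ • g i, fun i => ?_, ?_⟩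
    · apply subset_closure
      apply subset_convexHull
      simp only [Set.mem_iUnion]
      exact ⟨m, hm, Set.smul_mem_smul_set (hg i)⟩
    · simp [Finset.smul_sum]
  · have hcl : ∀ (S : Fin k → Set (EuclideanSpace ℝ (Fin p))) (s : Finset (Fin k)),
        ∑ i ∈ s, closure (S i) ⊆ closure (∑ i ∈ s, S i) := by
      intro S s
      induction s using Finset.induction_on with
      | empty => simpa using subset_closure
      | insert i s hi ih =>
        rw [Finset.sum_insert hi, Finset.sum_insert hi]
        rintro _ ⟨x, hx, y, hy, rfl⟩
        exact map_mem_closure₂ continuous_add hx (ih hy) fun a ha b hb => Set.add_mem_add ha hb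
    refine (hcl _ _).trans (closure_mono ?_)
    rw [← convexHull_sum]
    apply convexHull_mono
    intro x hx
    obtain ⟨g, hg, rfl⟩ := (Set.mem_fintype_sum _ _).1 hx
    simp only [Set.mem_iUnion] at hg
    choose m hm a ha hag using hg
    simp only [Set.mem_iUnion]
    have hM : 1 ≤ ∏ i, m i := Nat.succ_le_of_lt (Finset.prod_pos fun i _ => hm i)
    refine ⟨∏ i, m i, hM, ?_⟩
    have key : ∀ i, ∃ b ∈ Λ i (∏ j, m j), (((∏ j, m j : ℕ) : ℝ))⁻¹ • b = g i := by
      intro i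
      obtain ⟨n, hn⟩ := Finset.dvd_prod_of_mem m (Finset.mem_univ i)
      generalize (∏ j, m j) = M at hn hM
      obtain _ | n := n
      · simp at hn; omega
      refine ⟨(n + 1) • a i, ?_, ?_⟩
      · rw [hn, mul_comm]
        exact nsmul_mem_of_superadditive (Λ i) (hadd i) (m i) (hm i) (a i) (ha i) n
      · rw [← hag i, hn, ← Nat.cast_smul_eq_nsmul ℝ, smul_smul]
        have h0 : (m i : ℝ) ≠ 0 := by
          have := hm i
          positivity
        have h1 : ((n + 1 : ℕ) : ℝ) ≠ 0 := by positivity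
        show _ = (m i : ℝ)⁻¹ • a i
        congr 1
        push_cast at h1 ⊢
        field_simp
    choose b hb hbg using key
    refine ⟨∑ i, b i, (Set.mem_fintype_sum _ _).2 ⟨b, hb, rfl⟩, ?_⟩
    show _ • _ = _
    rw [Finset.smul_sum]
    exact Finset.sum_congr rfl fun i _ => hbg i
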